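/- Let θ1, θ2, θ3, θ4 > 0 with θ1 + θ2 + θ3 + θ4 = π and set a_i = cot θ_i. The smallest nonzero eigenvalue λ1 of L₄ satisfies λ1 ≤ 2, and equality holds if and only if θ1 = θ2 = θ3 = θ4 = π/4. (Among all cyclic quadrilaterals, a square has the maximal λ1.) -/

import Mathlib

open Real

/-- The elementary symmetric functions of degree one and three of the cotangents of four angles
with sum `π` agree. -/
lemma cot_symm_eq_of_add_eq_pi {x y z w : ℝ} (hx : sin x ≠ 0) (hy : sin y ≠ 0)
    (hz : sin z ≠ 0) (hw : sin w ≠ 0) (h : x + y + z + w = π) :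
    cot x * cot z * (cot y + cot w) + cot y * cot w * (cot x + cot z)
      = (cot x + cot z) + (cot y + cot w) := by
  have hs : sin (x + y + z + w) = 0 := by rw [h, sin_pi]
  simp only [sin_add, cos_add] at hs
  simp only [cot_eq_cos_div_sin]
  field_simp
  linear_combination hs

lemma eq_pi_div_four_of_cot_eq_one {x : ℝ} (h0 : 0 < x) (hpi : x < π) (h : cot x = 1) :
    x = π / 4 := by
  have hs := sin_pos_of_pos_of_lt_pi h0 hpi
  rw [cot_eq_cos_div_sin, div_eq_one_iff_eq hs.ne'] at h
  have h' : sin (x - π / 4) = 0 := by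
    rw [sin_sub, h, cos_pi_div_four, sin_pi_div_four]
    ring
  have := (sin_eq_zero_iff_of_lt_of_lt (by linarith [pi_pos]) (by linarith)).1 h'
  linarith

lemma cot_pi_div_four : cot (π / 4) = 1 := by
  rw [cot_eq_cos_div_sin, cos_pi_div_four, sin_pi_div_four, div_self (by positivity)]

/-- The least root of `(x - 2) ^ 2 * (x - 4)` is `2`. -/
lemma least_root_eq_two {l1 l2 l3 : ℝ} (h12 : l1 ≤ l2) (h23 : l2 ≤ l3)
    (hs1 : l1 + l2 + l3 = 8) (hs2 : l1 * l2 + l1 * l3 + l2 * l3 = 20)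
    (hs3 : l1 * l2 * l3 = 16) : l1 = 2 := by
  have h : (l1 - 2) ^ 2 * (l1 - 4) = 0 := by
    linear_combination l1 ^ 2 * hs1 - l1 * hs2 + hs3
  rcases mul_eq_zero.1 h with h | h
  · linarith [pow_eq_zero_iff (two_ne_zero) |>.1 h]
  · linarith

/-- Here `P, p` and `Q, q` are the sums and products of the two pairs of opposite edge weights,
and `l1 ≤ l2 ≤ l3` are the roots of the reduced characteristic polynomial. -/
lemma opposite_weights_of_two_le {P Q p q l1 l2 l3 : ℝ} (hp : 4 * p ≤ P ^ 2) (hq : 4 * q ≤ Q ^ 2)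
    (hcon : p * Q + q * P = P + Q) (hPQ : P ≤ Q) (h12 : l1 ≤ l2) (h23 : l2 ≤ l3)
    (hs1 : l1 + l2 + l3 = 2 * (P + Q))
    (hs2 : l1 * l2 + l1 * l3 + l2 * l3 = 3 * (P * Q) + 4 * (p + q))
    (hs3 : l1 * l2 * l3 = 4 * (P + Q)) (h2 : 2 ≤ l1) :
    P = 2 ∧ Q = 2 ∧ p = 1 ∧ q = 1 := by
  have hP : l1 ≤ P := by
    by_contra! hlt
    have hneg : 0 < (l1 - P) * (l2 - P) * (l3 - P) :=
      mul_pos (mul_pos (by linarith) (by linarith)) (by linarith)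
    have heq : (l1 - P) * (l2 - P) * (l3 - P) = -((P ^ 2 - 4 * p) * (Q - P)) := by
      linear_combination hs3 - P * hs2 + P ^ 2 * hs1 - 4 * hcon
    linarith [mul_nonneg (sub_nonneg.2 hp) (sub_nonneg.2 hPQ)]
  have hP2 : 2 ≤ P := h2.trans hP
  have hcubic : 0 ≤ (l1 - 2) * (l2 - 2) * (l3 - 2) :=
    mul_nonneg (mul_nonneg (by linarith) (by linarith)) (by linarith)
  have hquad : 0 ≤ (l1 - 2) * (l2 - 2) + (l1 - 2) * (l3 - 2) + (l2 - 2) * (l3 - 2) :=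
    add_nonneg (add_nonneg (mul_nonneg (by linarith) (by linarith))
      (mul_nonneg (by linarith) (by linarith))) (mul_nonneg (by linarith) (by linarith))
  have hc : (l1 - 2) * (l2 - 2) * (l3 - 2)
      = 12 * (P + Q) - 8 - 2 * (3 * (P * Q) + 4 * (p + q)) := by
    linear_combination hs3 - 2 * hs2 + 4 * hs1
  have hd : (l1 - 2) * (l2 - 2) + (l1 - 2) * (l3 - 2) + (l2 - 2) * (l3 - 2)
      = 3 * (P * Q) + 4 * (p + q) - 8 * (P + Q) + 12 := by
    linear_combination hs2 - 4 * hs1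
  rw [hc] at hcubic
  rw [hd] at hquad
  have hP' : P = 2 := by
    have hmul := mul_nonneg (by linarith : (0 : ℝ) ≤ P) hcubic
    have hkey : 6 * P * (P - 2) ^ 2 + 2 * (Q - P) * (P ^ 2 - 4 * p)
        + 4 * (Q - P) * (P - 1) * (P - 2)
        + P * (12 * (P + Q) - 8 - 2 * (3 * (P * Q) + 4 * (p + q))) = 0 := by
      linear_combination (-8) * hcon
    have t1 := mul_nonneg (sub_nonneg.2 hPQ) (sub_nonneg.2 hp)
    have t2 := mul_nonneg (mul_nonneg (sub_nonneg.2 hPQ) (by linarith : (0 : ℝ) ≤ P - 1))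
      (sub_nonneg.2 hP2)
    have t3 : 0 ≤ P * (P - 2) ^ 2 := by positivity
    have t4 : P * (P - 2) ^ 2 = 0 := by linarith
    rcases mul_eq_zero.1 t4 with h | h
    · linarith
    · linarith [pow_eq_zero_iff (two_ne_zero) |>.1 h]
  subst hP'
  have hp1 : p ≤ 1 := by linarith
  have hprod : (1 - p) * (Q - 2) = 0 :=
    le_antisymm (by linarith) (mul_nonneg (by linarith) (by linarith))
  have hQ : Q = 2 := by
    rcases mul_eq_zero.1 hprod with h | h
    · obtain rfl : p = 1 := by linarith
      linarith
    · linarith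
  subst hQ
  exact ⟨rfl, rfl, by linarith, by linarith⟩

lemma eq_one_of_add_eq_two_of_mul_eq_one {a b : ℝ} (hs : a + b = 2) (hm : a * b = 1) :
    a = 1 ∧ b = 1 := by
  have h : (a - 1) ^ 2 = 0 := by linear_combination a * hs - hm
  have := pow_eq_zero_iff (two_ne_zero) |>.1 h
  constructor <;> linarith

theorem lambda1_L4 (θ1 θ2 θ3 θ4 : ℝ)
    (h1 : 0 < θ1) (h2 : 0 < θ2) (h3 : 0 < θ3) (h4 : 0 < θ4)
    (hsum : θ1 + θ2 + θ3 + θ4 = Real.pi)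
    (a1 a2 a3 a4 : ℝ) (ha1 : a1 = Real.cot θ1) (ha2 : a2 = Real.cot θ2)
    (ha3 : a3 = Real.cot θ3) (ha4 : a4 = Real.cot θ4)
    (L : Matrix (Fin 4) (Fin 4) ℝ)
    (hL : L = !![a1 + a4, -a1, 0, -a4;
                 -a1, a1 + a2, -a2, 0;
                 0, -a2, a2 + a3, -a3;
                 -a4, 0, -a3, a3 + a4])
    (l1 l2 l3 : ℝ) (hl1 : 0 ≤ l1) (hl12 : l1 ≤ l2) (hl23 : l2 ≤ l3)
    (hchar : ∀ x : ℝ, (x • (1 : Matrix (Fin 4) (Fin 4) ℝ) - L).det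
      = x * (x - l1) * (x - l2) * (x - l3)) :
    l1 ≤ 2 ∧ (l1 = 2 ↔ θ1 = Real.pi / 4 ∧ θ2 = Real.pi / 4 ∧ θ3 = Real.pi / 4 ∧ θ4 = Real.pi / 4) := by
  have hπ := pi_pos
  have hsin : ∀ θ : ℝ, 0 < θ → θ < π → sin θ ≠ 0 := fun θ h h' ↦
    (sin_pos_of_pos_of_lt_pi h h').ne'
  have hcon : a1 * a3 * (a2 + a4) + a2 * a4 * (a1 + a3) = (a1 + a3) + (a2 + a4) := by
    rw [ha1, ha2, ha3, ha4]
    exact cot_symm_eq_of_add_eq_pi (hsin θ1 h1 (by linarith)) (hsin θ2 h2 (by linarith))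
      (hsin θ3 h3 (by linarith)) (hsin θ4 h4 (by linarith)) hsum
  have hpoly : ∀ x : ℝ, x * (x - l1) * (x - l2) * (x - l3)
      = x * (x ^ 3 - 2 * ((a1 + a3) + (a2 + a4)) * x ^ 2
        + (3 * ((a1 + a3) * (a2 + a4)) + 4 * (a1 * a3 + a2 * a4)) * x
        - 4 * (a1 * a3 * (a2 + a4) + a2 * a4 * (a1 + a3))) := by
    intro x
    rw [← hchar x, hL]
    simp [Matrix.det_succ_row_zero, Fin.sum_univ_succ, Fin.succAbove, Matrix.one_apply]
    ring
  have e1 := hpoly 1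
  have e2 := hpoly (-1)
  have e3 := hpoly 2
  have hs1 : l1 + l2 + l3 = 2 * ((a1 + a3) + (a2 + a4)) := by
    linarith
  have hs2 : l1 * l2 + l1 * l3 + l2 * l3
      = 3 * ((a1 + a3) * (a2 + a4)) + 4 * (a1 * a3 + a2 * a4) := by
    linarith
  have hs3 : l1 * l2 * l3 = 4 * ((a1 + a3) + (a2 + a4)) := by
    linarith
  have hp : 4 * (a1 * a3) ≤ (a1 + a3) ^ 2 := by linarith [sq_nonneg (a1 - a3)]
  have hq : 4 * (a2 * a4) ≤ (a2 + a4) ^ 2 := by linarith [sq_nonneg (a2 - a4)]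
  have hmax : 2 ≤ l1 → a1 = 1 ∧ a2 = 1 ∧ a3 = 1 ∧ a4 = 1 := by
    intro h
    have key : a1 + a3 = 2 ∧ a2 + a4 = 2 ∧ a1 * a3 = 1 ∧ a2 * a4 = 1 := by
      rcases le_total (a1 + a3) (a2 + a4) with hPQ | hPQ
      · exact opposite_weights_of_two_le hp hq hcon hPQ hl12 hl23 hs1 hs2 hs3 h
      · obtain ⟨hQ, hP, hq1, hp1⟩ := opposite_weights_of_two_le hq hp (by linarith) hPQ hl12 hl23
          (by linarith) (by linarith) (by linarith) h
        exact ⟨hP, hQ, hp1, hq1⟩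
    obtain ⟨hP, hQ, hp1, hq1⟩ := key
    obtain ⟨r1, r3⟩ := eq_one_of_add_eq_two_of_mul_eq_one hP hp1
    obtain ⟨r2, r4⟩ := eq_one_of_add_eq_two_of_mul_eq_one hQ hq1
    exact ⟨r1, r2, r3, r4⟩
  have hsquare : a1 = 1 ∧ a2 = 1 ∧ a3 = 1 ∧ a4 = 1 → l1 = 2 := by
    rintro ⟨r1, r2, r3, r4⟩
    rw [r1, r2, r3, r4] at hs1 hs2 hs3
    exact least_root_eq_two hl12 hl23 (by linarith) (by linarith) (by linarith)
  refine ⟨?_, fun h ↦ ?_, ?_⟩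
  · rcases le_total l1 2 with h | h
    · exact h
    · exact (hsquare (hmax h)).le
  · obtain ⟨r1, r2, r3, r4⟩ := hmax h.ge
    exact ⟨eq_pi_div_four_of_cot_eq_one h1 (by linarith) (ha1.symm.trans r1),
      eq_pi_div_four_of_cot_eq_one h2 (by linarith) (ha2.symm.trans r2),
      eq_pi_div_four_of_cot_eq_one h3 (by linarith) (ha3.symm.trans r3),
      eq_pi_div_four_of_cot_eq_one h4 (by linarith) (ha4.symm.trans r4)⟩
  · rintro ⟨rfl, rfl, rfl, rfl⟩
    exact hsquare ⟨ha1.trans cot_pi_div_four, ha2.trans cot_pi_div_four,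
      ha3.trans cot_pi_div_four, ha4.trans cot_pi_div_four⟩
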